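/- arXiv:1407.5575 — 3 statements merged into one kernel-verified Lean document; each statement's English description precedes it below -/
import Mathlib

section
/- Let a : ℕ → ℂ be a sequence, S ⊂ ℂ a finite set of roots of unity, α : S → ℂ with α(ξ) ≠ 0 for every ξ ∈ S, and d ≥ 0 an integer such that a(l) = ∑_{ξ ∈ S} α(ξ)·ξ^l for all l ≥ d. Then the smallest integer N > 0 such that a(l+N) = a(l) holds for all sufficiently large l is equal to the least common multiple of the multiplicative orders of the elements of S (equal to 1 if S is empty). -/
/-- Geometric sequences with distinct ratios are linearly independent. -/
theorem eq_zero_of_forall_sum_mul_pow_eq_zero {R : Type*} [CommRing R] [IsDomain R]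
    (S : Finset R) (c : R → R) (h : ∀ k : ℕ, ∑ ξ ∈ S, c ξ * ξ ^ k = 0) :
    ∀ ξ ∈ S, c ξ = 0 := by
  have hli := (linearIndependent_monoidHom (Multiplicative ℕ) R).comp _
    (powersHom R).injective
  refine linearIndependent_iff'.mp hli S c ?_
  ext k
  simpa [Finset.sum_apply, powersHom_apply] using h k.toAdd

/-- If `a l = ∑_{ξ ∈ S} α ξ * ξ^l` for all large `l`, where `S` is a finite
set of roots of unity and all coefficients `α ξ` are nonzero, then the smallest ultimate
period of `a` is the least common multiple of the multiplicative orders of the elements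
of `S` (which is `1` if `S` is empty). -/
theorem stmt2 (a : ℕ → ℂ) (S : Finset ℂ)
    (hS : ∀ ξ ∈ S, ∃ m : ℕ, 1 ≤ m ∧ ξ ^ m = 1)
    (α : ℂ → ℂ) (hα : ∀ ξ ∈ S, α ξ ≠ 0) (d : ℕ)
    (ha : ∀ l ≥ d, a l = ∑ ξ ∈ S, α ξ * ξ ^ l) :
    IsLeast {N : ℕ | 0 < N ∧ ∃ d' : ℕ, ∀ l ≥ d', a (l + N) = a l}
      (S.lcm orderOf) := by
  refine ⟨⟨?_, d, fun l hl => ?_⟩, ?_⟩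
  · refine Nat.pos_of_ne_zero fun h => ?_
    obtain ⟨ξ, hξ, h0⟩ := Finset.lcm_eq_zero_iff.mp h
    obtain ⟨m, hm, hξm⟩ := hS ξ hξ
    exact (orderOf_pos_iff.mpr (isOfFinOrder_iff_pow_eq_one.mpr ⟨m, hm, hξm⟩)).ne' h0
  · rw [ha l hl, ha _ (le_add_right hl)]
    refine Finset.sum_congr rfl fun ξ hξ => ?_
    rw [pow_add, orderOf_dvd_iff_pow_eq_one.mp (Finset.dvd_lcm hξ), mul_one]
  · rintro N ⟨hN, d', hper⟩
    refine Nat.le_of_dvd hN (Finset.lcm_dvd fun ξ hξ => orderOf_dvd_of_pow_eq_one ?_)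
    have hzero := eq_zero_of_forall_sum_mul_pow_eq_zero S
      (fun ξ => α ξ * (ξ ^ N - 1) * ξ ^ (d + d')) (fun k => by
        have h := hper (d + d' + k) (by omega)
        rw [ha _ (by omega), ha _ (by omega), ← sub_eq_zero, ← Finset.sum_sub_distrib] at h
        rw [← h]
        exact Finset.sum_congr rfl fun ξ _ => by ring) ξ hξ
    obtain ⟨m, hm, hξm⟩ := hS ξ hξ
    have hξ0 : ξ ≠ 0 := by
      rintro rfl
      simp [show m ≠ 0 by omega] at hξm
    simpa [hα ξ hξ, hξ0, sub_eq_zero] using hzero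
end

section
/- Let n, k, j be nonnegative integers with 1 ≤ n and 0 ≤ k ≤ n, and set d := gcd(n, j). Then the evaluation of the Gaussian binomial polynomial [n, k]_q at q = ξ_n^j equals the ordinary binomial coefficient C(d, k·d/n) if n divides k·d, and equals 0 otherwise. -/
/-- The Gaussian (q-)binomial coefficient `[n, k]_q` as a polynomial in `ℤ[q]`,
defined by `[n, 0] = 1`, `[0, k+1] = 0` and
`[n+1, k+1] = [n, k] + q^(k+1) * [n, k+1]` (so `[n, k] = 0` for `k > n`). -/
noncomputable def gaussBinom : ℕ → ℕ → Polynomial ℤ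
  | _, 0 => 1
  | 0, _ + 1 => 0
  | n + 1, k + 1 => gaussBinom n k + Polynomial.X ^ (k + 1) * gaussBinom n (k + 1)

section GaussBinom

open Polynomial

theorem gaussBinom_zero_right (n : ℕ) : gaussBinom n 0 = 1 := by
  cases n <;> rfl

theorem gaussBinom_zero_succ (k : ℕ) : gaussBinom 0 (k + 1) = 0 := rfl

theorem gaussBinom_succ_succ (n k : ℕ) :
    gaussBinom (n + 1) (k + 1) = gaussBinom n k + X ^ (k + 1) * gaussBinom n (k + 1) := rfl

theorem gaussBinom_eq_zero_of_lt {n k : ℕ} (h : n < k) : gaussBinom n k = 0 := by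
  induction n generalizing k with
  | zero =>
    obtain ⟨k, rfl⟩ := Nat.exists_eq_succ_of_ne_zero h.ne'
    rfl
  | succ n ih =>
    obtain ⟨k, rfl⟩ := Nat.exists_eq_succ_of_ne_zero (Nat.ne_zero_of_lt h)
    rw [gaussBinom_succ_succ, ih (by omega), ih (by omega), mul_zero, add_zero]

theorem gaussBinom_self (n : ℕ) : gaussBinom n n = 1 := by
  induction n with
  | zero => rfl
  | succ n ih =>
    rw [gaussBinom_succ_succ, ih, gaussBinom_eq_zero_of_lt n.lt_succ_self, mul_zero, add_zero]

/-- The absorption identity for Gaussian binomial coefficients. -/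
theorem one_sub_X_pow_mul_gaussBinom (n k : ℕ) :
    (1 - X ^ (k + 1)) * gaussBinom (n + 1) (k + 1) = (1 - X ^ (n + 1)) * gaussBinom n k := by
  induction n generalizing k with
  | zero =>
    cases k with
    | zero => simp [gaussBinom_self]
    | succ k =>
      rw [gaussBinom_eq_zero_of_lt (by omega), gaussBinom_zero_succ, mul_zero, mul_zero]
  | succ n ih =>
    rw [gaussBinom_succ_succ (n + 1) k]
    cases k with
    | zero =>
      have h := ih 0
      simp only [gaussBinom_zero_right] at h ⊢
      linear_combination X ^ (0 + 1) * h
    | succ k =>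
      have h₁ := ih (k + 1)
      have h₂ := ih k
      have h₃ := gaussBinom_succ_succ n k
      linear_combination X ^ (k + 2) * h₁ + X * h₂ - X * (1 - X ^ (n + 1)) * h₃

variable {R : Type*} [CommRing R]

/-- Adding the order of a root of unity `q` to the upper index acts on the values at `q`
like a step of Pascal's rule. -/
theorem IsPrimitiveRoot.aeval_gaussBinom_add [IsDomain R] {q : R} {m : ℕ}
    (hq : IsPrimitiveRoot q m) (hm : 0 < m) (n k : ℕ) :
    aeval q (gaussBinom (n + m) k) =
      aeval q (gaussBinom n k) + if m ≤ k then aeval q (gaussBinom n (k - m)) else 0 := by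
  induction n generalizing k with
  | zero =>
    rw [zero_add]
    rcases k with _ | k
    · simp [gaussBinom_zero_right, hm.ne']
    rw [gaussBinom_zero_succ, map_zero, zero_add]
    rcases lt_trichotomy (k + 1) m with h | h | h
    · rw [if_neg (by omega)]
      obtain ⟨m, rfl⟩ := Nat.exists_eq_succ_of_ne_zero hm.ne'
      have habs := congrArg (aeval q) (one_sub_X_pow_mul_gaussBinom m k)
      simp only [map_mul, map_sub, map_one, map_pow, aeval_X] at habs
      rw [hq.pow_eq_one, sub_self, zero_mul] at habs
      exact (mul_eq_zero.mp habs).resolve_left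
        (sub_ne_zero.mpr (hq.pow_ne_one_of_pos_of_lt k.succ_ne_zero h).symm)
    · simp [← h, gaussBinom_self]
    · rw [if_pos h.le, gaussBinom_eq_zero_of_lt h, gaussBinom_eq_zero_of_lt (by omega)]
  | succ n ih =>
    rcases k with _ | k
    · simp [gaussBinom_zero_right, hm.ne']
    rw [Nat.add_right_comm, gaussBinom_succ_succ, gaussBinom_succ_succ]
    simp only [map_add, map_mul, map_pow, aeval_X, ih]
    rcases lt_trichotomy m (k + 1) with h | h | h
    · obtain ⟨l, rfl⟩ := Nat.exists_eq_add_of_le (Nat.le_of_lt_succ h)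
      have e : m + l + 1 - m = l + 1 := by omega
      rw [if_pos (by omega), if_pos h.le, if_pos h.le, e, Nat.add_sub_cancel_left,
        gaussBinom_succ_succ]
      simp only [map_add, map_mul, map_pow, aeval_X]
      rw [add_assoc m l 1, pow_add q m, hq.pow_eq_one]
      ring
    · subst h
      simp [gaussBinom_zero_right, hq.pow_eq_one]
      ring
    · simp [show ¬ m ≤ k by omega, show ¬ m ≤ k + 1 by omega]

theorem IsPrimitiveRoot.aeval_gaussBinom_mul [IsDomain R] {q : R} {m : ℕ}
    (hq : IsPrimitiveRoot q m) (hm : 0 < m) (d k : ℕ) :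
    aeval q (gaussBinom (d * m) k) = if m ∣ k then (d.choose (k / m) : R) else 0 := by
  induction d generalizing k with
  | zero =>
    rw [zero_mul]
    rcases k with _ | k
    · simp [gaussBinom_zero_right]
    rw [gaussBinom_zero_succ, map_zero]
    split_ifs with h
    · rw [Nat.choose_eq_zero_of_lt (Nat.div_pos (Nat.le_of_dvd k.succ_pos h) hm), Nat.cast_zero]
    · rfl
  | succ d ih =>
    rw [Nat.succ_mul, hq.aeval_gaussBinom_add hm, ih, ih]
    by_cases h : m ≤ k
    · obtain ⟨l, rfl⟩ := Nat.exists_eq_add_of_le h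
      rw [if_pos h, Nat.add_sub_cancel_left, Nat.add_div_left _ hm, Nat.choose_succ_succ]
      simp only [Nat.dvd_add_right (dvd_refl m)]
      split_ifs
      · push_cast
        ring
      · rw [add_zero]
    · rw [if_neg h, Nat.div_eq_of_lt (not_le.mp h)]
      simp

end GaussBinom

/-- for `1 ≤ n`, `0 ≤ k ≤ n`, `j ≥ 0` and `d = gcd(n, j)`, the value
`[n, k]_q` at `q = ξ_n^j` is the binomial coefficient `C(d, k d / n)` if `n ∣ k d`,
and `0` otherwise. -/
theorem stmt6 (n k j : ℕ) (hn : 1 ≤ n) (hk : k ≤ n) :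
    Polynomial.aeval (Complex.exp (2 * Real.pi * Complex.I / n) ^ j) (gaussBinom n k)
    = if n ∣ k * Nat.gcd n j
        then ((Nat.gcd n j).choose (k * Nat.gcd n j / n) : ℂ)
        else 0 := by
  have hζ := Complex.isPrimitiveRoot_exp n (by omega)
  have hd : 0 < n.gcd j := Nat.gcd_pos_of_pos_left j hn
  obtain ⟨m, hm⟩ := Nat.gcd_dvd_left n j
  have hm₀ : 0 < m := Nat.pos_of_mul_pos_left (hm ▸ hn)
  have hq : IsPrimitiveRoot (Complex.exp (2 * Real.pi * Complex.I / n) ^ j) m := by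
    rw [IsPrimitiveRoot.iff_orderOf, (isOfFinOrder_iff_pow_eq_one.mpr ⟨n, hn, hζ.pow_eq_one⟩).orderOf_pow,
      ← hζ.eq_orderOf]
    exact Nat.div_eq_of_eq_mul_right hd hm
  have h := hq.aeval_gaussBinom_mul hm₀ (n.gcd j) k
  rw [← hm] at h
  have hdvd : n ∣ k * n.gcd j ↔ m ∣ k := by
    conv_lhs => rw [mul_comm k]; lhs; rw [hm]
    exact Nat.mul_dvd_mul_iff_left hd
  have hdiv : k * n.gcd j / n = k / m := by
    conv_lhs => rw [mul_comm k]; rhs; rw [hm]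
    exact Nat.mul_div_mul_left _ _ hd
  rw [h, hdiv]
  simp only [hdvd]
end

section
/- Let n ≥ 1, k ≥ 0, j ≥ 0 be integers, set d := gcd(n, j), and assume that n divides k·d. Then the integers k − k·d/n and k·(k−1)·j/n are both well defined (i.e., n divides k·d and n divides k·(k−1)·j) and have the same parity: k − k·d/n ≡ k·(k−1)·j/n (mod 2). -/
/-- For coprime `m ≥ 1` and `i`, the integers `m c - c` and `c (m c - 1) i` have the same parity. -/
theorem mul_sub_mod_two_eq {m i c : ℕ} (hm : 0 < m) (hmi : m.Coprime i) :
    (m * c - c) % 2 = (c * (m * c - 1) * i) % 2 := by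
  obtain rfl | hc := Nat.eq_zero_or_pos c
  · simp
  have hle : c ≤ m * c := Nat.le_mul_of_pos_left c hm
  have hpos : 1 ≤ m * c := Nat.mul_pos hm hc
  have hodd : Even m → Odd i := fun h => by
    by_contra hi
    rw [Nat.not_odd_iff_even] at hi
    exact Nat.not_coprime_of_dvd_of_dvd one_lt_two h.two_dvd hi.two_dvd hmi
  have hparity : Even (m * c - c) ↔ Even (c * (m * c - 1) * i) := by
    simp only [Nat.even_sub hle, Nat.even_mul, Nat.even_sub hpos, Nat.not_even_one]
    rw [← Nat.not_even_iff_odd] at hodd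
    tauto
  rw [Nat.even_iff, Nat.even_iff] at hparity
  omega

/-- for `n ≥ 1`, `k, j ≥ 0`, `d = gcd(n, j)` with `n ∣ k d`, the integers
`k - k d / n` and `k (k-1) j / n` are well defined (`n` also divides `k (k-1) j`) and
have the same parity. -/
theorem stmt7 (n k j : ℕ) (hn : 1 ≤ n) (hd : n ∣ k * Nat.gcd n j) :
    n ∣ k * (k - 1) * j ∧
    (k - k * Nat.gcd n j / n) % 2 = (k * (k - 1) * j / n) % 2 := by
  obtain ⟨d, m, i, hdpos, hmi, rfl, rfl⟩ := Nat.exists_coprime' (Nat.gcd_pos_of_pos_left j hn)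
  have hm : 0 < m := Nat.pos_of_mul_pos_right hn
  rw [Nat.gcd_mul_right, hmi.gcd_eq_one, one_mul] at hd ⊢
  obtain ⟨c, rfl⟩ := Nat.dvd_of_mul_dvd_mul_right hdpos hd
  have hleft : m * c * d / (m * d) = c :=
    Nat.div_eq_of_eq_mul_right hn (by ring)
  have hprod : m * c * (m * c - 1) * (i * d) = m * d * (c * (m * c - 1) * i) := by ring
  refine ⟨⟨_, hprod⟩, ?_⟩
  rw [hleft, Nat.div_eq_of_eq_mul_right hn hprod]
  exact mul_sub_mod_two_eq hm hmi
end
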